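/- arXiv:1907.08921 — 2 statements merged into one kernel-verified Lean document; each statement's English description precedes it below -/
import Mathlib

section
/- The map K ↦ X(K) is real-analytic on the open set S, and consequently the LQR cost f(K) = Tr(X(K)Σ) is real-analytic on S. -/
open Matrix

attribute [local instance] Matrix.normedAddCommGroup Matrix.normedSpace

/-- `M` is Schur stable: spectral radius `ρ(M) < 1`. -/
def IsSchur {k : ℕ} (M : Matrix (Fin k) (Fin k) ℝ) : Prop :=
  ∀ μ ∈ spectrum ℂ (M.map (Complex.ofReal ·)), ‖μ‖ < 1

open Filter Topology

theorem tendsto_pow_zero_of_spectrum {𝔸 : Type*} [NormedRing 𝔸] [NormedAlgebra ℂ 𝔸]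
    [CompleteSpace 𝔸] [Nontrivial 𝔸] {a : 𝔸} (h : ∀ μ ∈ spectrum ℂ a, ‖μ‖ < 1) :
    Tendsto (fun k : ℕ => a ^ k) atTop (𝓝 0) := by
  have h1 : spectralRadius ℂ a < (1 : NNReal) :=
    spectrum.spectralRadius_lt_of_forall_lt a (fun μ hμ => by exact_mod_cast h μ hμ)
  obtain ⟨r, hr, hr1⟩ := ENNReal.lt_iff_exists_nnreal_btwn.1 h1
  have hr1' : r < 1 := by exact_mod_cast hr1
  have h2 := (spectrum.pow_nnnorm_pow_one_div_tendsto_nhds_spectralRadius a).eventually_lt_const hr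
  refine squeeze_zero_norm' (a := fun k : ℕ => (r : ℝ) ^ k) ?_
    (tendsto_pow_atTop_nhds_zero_of_lt_one r.2 (by exact_mod_cast hr1'))
  filter_upwards [h2, eventually_gt_atTop 0] with k hk hk0
  have hk' : (0 : ℝ) < k := by exact_mod_cast hk0
  have h3 := ENNReal.rpow_lt_rpow hk hk'
  rw [← ENNReal.rpow_mul, one_div_mul_cancel hk'.ne', ENNReal.rpow_one, ENNReal.rpow_natCast] at h3
  have h4 : ‖a ^ k‖₊ < r ^ k := by exact_mod_cast h3
  exact_mod_cast h4.le

theorem isOpen_spectrum_lt {𝔸 : Type*} [NormedRing 𝔸] [NormedAlgebra ℂ 𝔸]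
    [CompleteSpace 𝔸] [Nontrivial 𝔸] [NormOneClass 𝔸] :
    IsOpen {a : 𝔸 | ∀ μ ∈ spectrum ℂ a, ‖μ‖ < 1} := by
  have : {a : 𝔸 | ∀ μ ∈ spectrum ℂ a, ‖μ‖ < 1} = ⋃ k : ℕ, {a : 𝔸 | ‖a ^ (k+1)‖ < 1} := by
    ext a
    simp only [Set.mem_ofPred_eq, Set.mem_iUnion]
    constructor
    · intro h
      have h1 := ((tendsto_pow_zero_of_spectrum h).norm.comp (tendsto_add_atTop_nat 1))
      rw [norm_zero] at h1
      exact (h1.eventually_lt_const zero_lt_one).exists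
    · rintro ⟨k, hk⟩ μ hμ
      have h1 := spectrum.norm_le_norm_of_mem (spectrum.pow_mem_pow a (k + 1) hμ)
      rw [norm_pow] at h1
      by_contra! h2
      exact absurd (one_le_pow₀ h2 (n := k + 1)) (not_le.2 (h1.trans_lt hk))
  rw [this]
  exact isOpen_iUnion fun k => isOpen_lt (by fun_prop) continuous_const

/-- The entrywise complexification of a real square matrix, as an operator on `ℂᵏ`. -/
noncomputable def complexOperator {k : ℕ} (M : Matrix (Fin k) (Fin k) ℝ) :
    EuclideanSpace ℂ (Fin k) →L[ℂ] EuclideanSpace ℂ (Fin k) :=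
  Matrix.toEuclideanCLM (𝕜 := ℂ) (n := Fin k) (M.map (Complex.ofReal ·))

theorem isSchur_iff_complexOperator {k : ℕ} (M : Matrix (Fin k) (Fin k) ℝ) :
    IsSchur M ↔ ∀ μ ∈ spectrum ℂ (complexOperator M), ‖μ‖ < 1 := by
  unfold complexOperator IsSchur
  rw [AlgEquiv.spectrum_eq (Matrix.toEuclideanCLM (𝕜 := ℂ) (n := Fin k))]

theorem continuous_complexOperator {k : ℕ} : Continuous (complexOperator (k := k)) := by
  have h : Continuous (Matrix.toEuclideanCLM (𝕜 := ℂ) (n := Fin k)) :=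
    LinearMap.continuous_of_finiteDimensional
      (Matrix.toEuclideanCLM (𝕜 := ℂ) (n := Fin k)).toAlgEquiv.toLinearMap
  exact h.comp (continuous_id.matrix_map Complex.continuous_ofReal)

theorem isOpen_setOf_isSchur {k : ℕ} (hk : 0 < k) :
    IsOpen {M : Matrix (Fin k) (Fin k) ℝ | IsSchur M} := by
  have : NeZero k := ⟨hk.ne'⟩
  simp only [isSchur_iff_complexOperator]
  exact isOpen_spectrum_lt.preimage continuous_complexOperator

theorem IsSchur.tendsto_pow {k : ℕ} (hk : 0 < k) {M : Matrix (Fin k) (Fin k) ℝ} (h : IsSchur M) :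
    Tendsto (fun j : ℕ => M ^ j) atTop (𝓝 0) := by
  have : NeZero k := ⟨hk.ne'⟩
  have h1 := tendsto_pow_zero_of_spectrum ((isSchur_iff_complexOperator M).1 h)
  let e := Matrix.toEuclideanCLM (𝕜 := ℂ) (n := Fin k)
  have h2 : Continuous e.symm :=
    LinearMap.continuous_of_finiteDimensional e.symm.toAlgEquiv.toLinearMap
  have h3 : Continuous fun N : Matrix (Fin k) (Fin k) ℂ => N.map Complex.re :=
    continuous_id.matrix_map Complex.continuous_re
  have h4 := ((h3.comp h2).tendsto 0).comp h1
  have h5 (j : ℕ) : (M.map (Complex.ofReal ·)) ^ j = (M ^ j).map (Complex.ofReal ·) :=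
    (map_pow (Complex.ofRealHom.mapMatrix (m := Fin k)) M j).symm
  convert! h4 using 2 with j
  · ext a b
    simp [complexOperator, e, ← map_pow, h5]

theorem IsSchur.eq_zero_of_transpose_mul_mul_eq {k : ℕ} (hk : 0 < k)
    {M Y : Matrix (Fin k) (Fin k) ℝ} (h : IsSchur M) (hY : Mᵀ * Y * M = Y) : Y = 0 := by
  have h1 (j : ℕ) : (M ^ j)ᵀ * Y * M ^ j = Y := by
    induction j with
    | zero => simp
    | succ j ih =>
      calc (M ^ (j + 1))ᵀ * Y * M ^ (j + 1) = (M ^ j)ᵀ * (Mᵀ * Y * M) * M ^ j := by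
            nth_rw 1 [pow_succ']
            rw [pow_succ', Matrix.transpose_mul]
            simp only [Matrix.mul_assoc]
        _ = Y := by rw [hY, ih]
  have h2 := h.tendsto_pow hk
  have h3 : Continuous fun N : Matrix (Fin k) (Fin k) ℝ => Nᵀ * Y * N := by fun_prop
  have h4 := (h3.tendsto 0).comp h2
  simp only [Function.comp_def, h1, Matrix.mul_zero] at h4
  exact tendsto_nhds_unique tendsto_const_nhds h4

theorem LinearMap.analyticAt_of_finiteDimensional {E F : Type*} [NormedAddCommGroup E]
    [NormedSpace ℝ E] [FiniteDimensional ℝ E] [NormedAddCommGroup F] [NormedSpace ℝ F]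
    (f : E →ₗ[ℝ] F) (x : E) : AnalyticAt ℝ f x :=
  (LinearMap.toContinuousLinearMap f).analyticAt x

theorem AnalyticAt.matrix_mul {E : Type*} [NormedAddCommGroup E] [NormedSpace ℝ E] {p q r : ℕ}
    {f : E → Matrix (Fin p) (Fin q) ℝ} {g : E → Matrix (Fin q) (Fin r) ℝ} {x : E}
    (hf : AnalyticAt ℝ f x) (hg : AnalyticAt ℝ g x) : AnalyticAt ℝ (fun y => f y * g y) x := by
  have hf' (i : Fin p) (j : Fin q) : AnalyticAt ℝ (fun y => f y i j) x :=
    analyticAt_pi_iff.1 (analyticAt_pi_iff.1 hf i) j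
  have hg' (i : Fin q) (j : Fin r) : AnalyticAt ℝ (fun y => g y i j) x :=
    analyticAt_pi_iff.1 (analyticAt_pi_iff.1 hg i) j
  refine analyticAt_pi_iff.2 fun i => analyticAt_pi_iff.2 fun j => ?_
  simp only [Matrix.mul_apply]
  exact Finset.analyticAt_fun_sum _ fun l _ => (hf' i l).mul (hg' l j)

theorem AnalyticAt.matrix_transpose {E : Type*} [NormedAddCommGroup E] [NormedSpace ℝ E] {p q : ℕ}
    {f : E → Matrix (Fin p) (Fin q) ℝ} {x : E} (hf : AnalyticAt ℝ f x) :
    AnalyticAt ℝ (fun y => (f y)ᵀ) x :=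
  ((Matrix.transposeLinearEquiv (Fin p) (Fin q) ℝ ℝ).toLinearMap.analyticAt_of_finiteDimensional
    (f x)).comp hf

/-- Solutions of a linear system with analytic coefficients and right-hand side are analytic at
every point where the system is nonsingular. -/
theorem analyticAt_of_linear_eq {E V : Type*} [NormedAddCommGroup E] [NormedSpace ℝ E]
    [NormedAddCommGroup V] [NormedSpace ℝ V] [FiniteDimensional ℝ V] {T : E → V →ₗ[ℝ] V}
    {b X : E → V} {x : E} (hT : ∀ v, AnalyticAt ℝ (fun y => T y v) x) (hb : AnalyticAt ℝ b x)
    (hinj : Function.Injective (T x)) (hX : ∀ᶠ y in 𝓝 x, T y (X y) = b y) :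
    AnalyticAt ℝ X x := by
  have : CompleteSpace V := FiniteDimensional.complete ℝ V
  let T' : E → V →L[ℝ] V := fun y => LinearMap.toContinuousLinearMap (T y)
  let e := Module.finBasis ℝ V
  have hsum (y : E) : T' y = ∑ i, ContinuousLinearMap.smulRightL ℝ V V
      (LinearMap.toContinuousLinearMap (e.coord i)) (T y (e i)) := by
    ext v
    have h : T y v = ∑ i, e.repr v i • T y (e i) := by
      conv_lhs => rw [← e.sum_repr v]
      simp only [map_sum, map_smul]
    simpa [T'] using h
  have hT' : AnalyticAt ℝ T' x := by
    rw [funext hsum]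
    exact Finset.analyticAt_fun_sum _ fun i _ =>
      (ContinuousLinearMap.analyticAt _ _).comp (hT (e i))
  have hunit : IsUnit (T' x) :=
    ContinuousLinearMap.isUnit_iff_bijective.2 ⟨hinj, LinearMap.injective_iff_surjective.1 hinj⟩
  obtain ⟨u, hu⟩ := id hunit
  have hinv : AnalyticAt ℝ (fun y => Ring.inverse (T' y)) x :=
    (hu ▸ analyticAt_inverse (𝕜 := ℝ) u : AnalyticAt ℝ Ring.inverse (T' x)).comp hT'
  have happ : AnalyticAt ℝ (fun y => Ring.inverse (T' y) (b y)) x :=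
    ((ContinuousLinearMap.id ℝ (V →L[ℝ] V)).analyticAt_bilinear (Ring.inverse (T' x), b x)).comp₂
      hinv hb
  refine happ.congr ?_
  filter_upwards [hX, hT'.continuousAt.eventually (Units.isOpen.mem_nhds hunit)] with y hy hy'
  have hTy : T' y (X y) = b y := hy
  rw [← hTy, ← mul_apply_eq_comp, Ring.inverse_mul_cancel _ hy']
  rfl

theorem stmt2 {n m : ℕ} (hn : 0 < n) (hm : 0 < m)
    (A : Matrix (Fin n) (Fin n) ℝ) (B : Matrix (Fin n) (Fin m) ℝ)
    (Q Sig : Matrix (Fin n) (Fin n) ℝ) (R : Matrix (Fin m) (Fin m) ℝ)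
    (hQ : Q.PosDef) (hR : R.PosDef) (hSig : Sig.PosDef)
    (X : Matrix (Fin m) (Fin n) ℝ → Matrix (Fin n) (Fin n) ℝ)
    (hX : ∀ K, IsSchur (A - B * K) →
      (A - B * K)ᵀ * X K * (A - B * K) + Kᵀ * R * K + Q = X K) :
    AnalyticOnNhd ℝ X {K : Matrix (Fin m) (Fin n) ℝ | IsSchur (A - B * K)} ∧
    AnalyticOnNhd ℝ (fun K => Matrix.trace (X K * Sig))
      {K : Matrix (Fin m) (Fin n) ℝ | IsSchur (A - B * K)} := by
  have hopen : IsOpen {K : Matrix (Fin m) (Fin n) ℝ | IsSchur (A - B * K)} :=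
    (isOpen_setOf_isSchur hn).preimage (by fun_prop)
  have hXan : AnalyticOnNhd ℝ X {K : Matrix (Fin m) (Fin n) ℝ | IsSchur (A - B * K)} := by
    intro K hK
    have hid : AnalyticAt ℝ (fun K : Matrix (Fin m) (Fin n) ℝ => K) K := analyticAt_id
    have hcl : AnalyticAt ℝ (fun K : Matrix (Fin m) (Fin n) ℝ => A - B * K) K :=
      analyticAt_const.sub (analyticAt_const.matrix_mul hid)
    have hrhs : AnalyticAt ℝ (fun K : Matrix (Fin m) (Fin n) ℝ => Kᵀ * R * K + Q) K :=
      ((hid.matrix_transpose.matrix_mul analyticAt_const).matrix_mul hid).add analyticAt_const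
    refine analyticAt_of_linear_eq (T := fun L : Matrix (Fin m) (Fin n) ℝ =>
      { toFun := fun Y => Y - (A - B * L)ᵀ * Y * (A - B * L)
        map_add' := fun Y Z => ?_
        map_smul' := fun c Y => ?_ }) (fun Y => ?_) hrhs ?_ ?_
    · rw [Matrix.mul_add, Matrix.add_mul]
      abel
    · rw [Matrix.mul_smul, Matrix.smul_mul]
      exact (smul_sub c _ _).symm
    · exact analyticAt_const.sub
        ((hcl.matrix_transpose.matrix_mul analyticAt_const).matrix_mul hcl)
    · rw [injective_iff_map_eq_zero]
      intro Y hY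
      exact IsSchur.eq_zero_of_transpose_mul_mul_eq hn hK (sub_eq_zero.1 hY).symm
    · filter_upwards [hopen.mem_nhds hK] with L hL
      exact sub_eq_iff_eq_add'.2 ((hX L hL).symm.trans (add_assoc _ _ _))
  refine ⟨hXan, fun K hK => ?_⟩
  exact ((Matrix.traceLinearMap (Fin n) ℝ ℝ).analyticAt_of_finiteDimensional _).comp
    ((hXan K hK).matrix_mul analyticAt_const)
end

section
/- For every α > 0, the sublevel set S_α = {K ∈ S : f(K) ≤ α} is a compact subset of ℝ^{m×n}. -/
open Matrix

open Filter Topology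

section LinftyOp

attribute [local instance] Matrix.linftyOpNormedRing Matrix.linftyOpNormedAlgebra

/-- Powers of a complex matrix with spectrum in the open unit disc tend to zero. -/
lemma tendsto_pow_zero_of_spectrum_lt_one {k : ℕ} (M : Matrix (Fin k) (Fin k) ℂ)
    (hM : ∀ μ ∈ spectrum ℂ M, ‖μ‖ < 1) : Tendsto (fun j : ℕ => M ^ j) atTop (𝓝 0) := by
  rcases subsingleton_or_nontrivial (Matrix (Fin k) (Fin k) ℂ) with hs | hs
  · exact tendsto_const_nhds.congr fun j => Subsingleton.elim _ _
  have : CompleteSpace (Matrix (Fin k) (Fin k) ℂ) := FiniteDimensional.complete ℂ _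
  have hr : spectralRadius ℂ M < (1 : NNReal) :=
    spectrum.spectralRadius_lt_of_forall_lt M fun μ hμ => by
      exact_mod_cast hM μ hμ
  obtain ⟨r, hr1, hr2⟩ := ENNReal.lt_iff_exists_nnreal_btwn.mp hr
  have hr2' : r < 1 := by exact_mod_cast hr2
  have hev := (spectrum.pow_nnnorm_pow_one_div_tendsto_nhds_spectralRadius M).eventually_lt_const hr1
  refine squeeze_zero_norm' (a := fun j : ℕ => (r : ℝ) ^ j) ?_
    (tendsto_pow_atTop_nhds_zero_of_lt_one r.2 (by exact_mod_cast hr2'))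
  filter_upwards [hev, eventually_ge_atTop 1] with j hj hj1
  have hj0 : (0 : ℝ) < j := by exact_mod_cast hj1
  have h := ENNReal.rpow_le_rpow hj.le hj0.le
  rw [← ENNReal.rpow_mul, one_div, inv_mul_cancel₀ hj0.ne', ENNReal.rpow_one,
    ENNReal.rpow_natCast] at h
  exact_mod_cast h

end LinftyOp

/-- Powers of a Schur stable matrix tend to zero. -/
lemma IsSchur.tendsto_pow_zero {k : ℕ} {M : Matrix (Fin k) (Fin k) ℝ} (hM : IsSchur M) :
    Tendsto (fun j : ℕ => M ^ j) atTop (𝓝 0) := by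
  have h := tendsto_pow_zero_of_spectrum_lt_one _ hM
  have hre : Continuous fun N : Matrix (Fin k) (Fin k) ℂ => N.map Complex.re :=
    continuous_id.matrix_map Complex.continuous_re
  have h2 := (hre.tendsto 0).comp h
  have h0 : (0 : Matrix (Fin k) (Fin k) ℂ).map Complex.re = 0 := by ext; simp
  rw [h0] at h2
  refine h2.congr fun j => ?_
  have : (M.map (Complex.ofReal ·)) ^ j = (M ^ j).map (Complex.ofReal ·) :=
    (map_pow (Complex.ofRealHom.mapMatrix) M j).symm
  simp only [Function.comp_apply, this]
  ext
  simp

lemma IsSchur.tendsto_conj_pow_zero {k : ℕ} {M : Matrix (Fin k) (Fin k) ℝ} (hM : IsSchur M)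
    (X : Matrix (Fin k) (Fin k) ℝ) :
    Tendsto (fun j : ℕ => (M ^ j)ᵀ * X * M ^ j) atTop (𝓝 0) := by
  have hc : Continuous fun N : Matrix (Fin k) (Fin k) ℝ => Nᵀ * X * N := by fun_prop
  have h := (hc.tendsto 0).comp hM.tendsto_pow_zero
  rw [mul_zero] at h
  exact h

/-- The cone of positive semidefinite real matrices is closed. -/
lemma isClosed_setOf_posSemidef {k : ℕ} :
    IsClosed {X : Matrix (Fin k) (Fin k) ℝ | X.PosSemidef} := by
  simp only [posSemidef_iff_dotProduct_mulVec, Set.ofPred_and, Set.ofPred_forall]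
  refine IsClosed.inter (isClosed_eq (by fun_prop) (by fun_prop)) (isClosed_iInter fun x => ?_)
  exact isClosed_le (by fun_prop) (by fun_prop)

/-- Solutions of a Lyapunov equation with Schur stable coefficient and positive semidefinite
right-hand side are positive semidefinite. -/
lemma IsSchur.posSemidef_of_lyapunov {k : ℕ} {M X W : Matrix (Fin k) (Fin k) ℝ} (hM : IsSchur M)
    (hW : W.PosSemidef) (hX : Mᵀ * X * M + W = X) : X.PosSemidef := by
  have key : ∀ j : ℕ, (X - (M ^ j)ᵀ * X * M ^ j).PosSemidef := by
    intro j
    induction j with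
    | zero => simpa using PosSemidef.zero
    | succ j ih =>
      have h1 := hW.add (ih.conjTranspose_mul_mul_same M)
      have h2 : X - (M ^ (j + 1))ᵀ * X * M ^ (j + 1) =
          W + Mᴴ * (X - (M ^ j)ᵀ * X * M ^ j) * M := by
        rw [conjTranspose_eq_transpose_of_trivial, pow_succ, transpose_mul]
        nth_rewrite 1 [← hX]
        noncomm_ring
      rw [h2]
      exact h1
  have hlim : Tendsto (fun j : ℕ => X - (M ^ j)ᵀ * X * M ^ j) atTop (𝓝 X) := by
    simpa using tendsto_const_nhds.sub (hM.tendsto_conj_pow_zero X)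
  exact isClosed_setOf_posSemidef.mem_of_tendsto hlim (Eventually.of_forall key)

/-- Lyapunov equations with Schur stable coefficient have at most one solution. -/
lemma IsSchur.lyapunov_unique {k : ℕ} {M X Y W : Matrix (Fin k) (Fin k) ℝ} (hM : IsSchur M)
    (hX : Mᵀ * X * M + W = X) (hY : Mᵀ * Y * M + W = Y) : X = Y := by
  have hD : Mᵀ * (X - Y) * M = X - Y := by
    nth_rewrite 2 [← hX, ← hY]
    noncomm_ring
  have key : ∀ j : ℕ, (M ^ j)ᵀ * (X - Y) * M ^ j = X - Y := by
    intro j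
    induction j with
    | zero => simp
    | succ j ih =>
      calc (M ^ (j + 1))ᵀ * (X - Y) * M ^ (j + 1)
          = Mᵀ * ((M ^ j)ᵀ * (X - Y) * M ^ j) * M := by
            rw [pow_succ, transpose_mul]; noncomm_ring
        _ = X - Y := by rw [ih, hD]
  have h := hM.tendsto_conj_pow_zero (X - Y)
  simp only [key] at h
  exact sub_eq_zero.mp (tendsto_nhds_unique tendsto_const_nhds h)

lemma dotProduct_lyapunov {k : ℕ} {M X W : Matrix (Fin k) (Fin k) ℝ}
    (hX : Mᵀ * X * M + W = X) (x : Fin k → ℝ) :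
    (M *ᵥ x) ⬝ᵥ (X *ᵥ (M *ᵥ x)) + x ⬝ᵥ (W *ᵥ x) = x ⬝ᵥ (X *ᵥ x) := by
  nth_rewrite 2 [← hX]
  rw [add_mulVec, dotProduct_add, ← mulVec_mulVec, ← mulVec_mulVec, dotProduct_mulVec x Mᵀ,
    vecMul_transpose]

/-- A matrix admitting a positive semidefinite solution of a Lyapunov equation with positive
definite right-hand side is Schur stable. -/
lemma isSchur_of_lyapunov {k : ℕ} {M X W : Matrix (Fin k) (Fin k) ℝ} (hXp : X.PosSemidef)
    (hW : W.PosDef) (hX : Mᵀ * X * M + W = X) : IsSchur M := by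
  intro μ hμ
  rw [spectrum.mem_iff, Matrix.isUnit_iff_isUnit_det, isUnit_iff_ne_zero, not_not,
    ← Matrix.exists_mulVec_eq_zero_iff] at hμ
  obtain ⟨v, hv0, hv⟩ := hμ
  rw [sub_mulVec, sub_eq_zero, Algebra.algebraMap_eq_smul_one, smul_mulVec, one_mulVec] at hv
  set a : Fin k → ℝ := fun i => (v i).re with ha
  set b : Fin k → ℝ := fun i => (v i).im with hb
  have hMa : M *ᵥ a = μ.re • a - μ.im • b := by
    ext i
    have := congrArg Complex.re (congrFun hv i)
    simp [mulVec, dotProduct] at this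
    simp [mulVec, dotProduct, ha, hb, this]
  have hMb : M *ᵥ b = μ.re • b + μ.im • a := by
    ext i
    have := congrArg Complex.im (congrFun hv i)
    simp [mulVec, dotProduct] at this
    simp [mulVec, dotProduct, ha, hb, this]
  have hqa := dotProduct_lyapunov hX a
  have hqb := dotProduct_lyapunov hX b
  rw [hMa] at hqa
  rw [hMb] at hqb
  simp only [mulVec_sub, mulVec_add, mulVec_smul, dotProduct_sub, dotProduct_add, dotProduct_smul,
    sub_dotProduct, add_dotProduct, smul_dotProduct, smul_eq_mul] at hqa hqb
  have hXa : 0 ≤ a ⬝ᵥ (X *ᵥ a) := by simpa using hXp.dotProduct_mulVec_nonneg a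
  have hXb : 0 ≤ b ⬝ᵥ (X *ᵥ b) := by simpa using hXp.dotProduct_mulVec_nonneg b
  have hWa : 0 ≤ a ⬝ᵥ (W *ᵥ a) := by simpa using hW.posSemidef.dotProduct_mulVec_nonneg a
  have hWb : 0 ≤ b ⬝ᵥ (W *ᵥ b) := by simpa using hW.posSemidef.dotProduct_mulVec_nonneg b
  have hWpos : 0 < a ⬝ᵥ (W *ᵥ a) + b ⬝ᵥ (W *ᵥ b) := by
    by_cases ha0 : a = 0
    · have hb0 : b ≠ 0 := fun hb0 => hv0 <| funext fun i =>
        Complex.ext (congrFun ha0 i) (congrFun hb0 i)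
      have : 0 < b ⬝ᵥ (W *ᵥ b) := by simpa using hW.dotProduct_mulVec_pos hb0
      linarith
    · have : 0 < a ⬝ᵥ (W *ᵥ a) := by simpa using hW.dotProduct_mulVec_pos ha0
      linarith
  have hsum : (μ.re ^ 2 + μ.im ^ 2) * (a ⬝ᵥ (X *ᵥ a) + b ⬝ᵥ (X *ᵥ b))
      + (a ⬝ᵥ (W *ᵥ a) + b ⬝ᵥ (W *ᵥ b)) = a ⬝ᵥ (X *ᵥ a) + b ⬝ᵥ (X *ᵥ b) := by
    linear_combination hqa + hqb
  by_contra! hge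
  have h1 : 1 ≤ μ.re ^ 2 + μ.im ^ 2 := by
    have := Complex.sq_norm μ
    rw [Complex.normSq_apply] at this
    nlinarith
  nlinarith [mul_nonneg (sub_nonneg.mpr h1) (add_nonneg hXa hXb)]

/-- A positive definite quadratic form is bounded below by a multiple of the squared sup norm. -/
lemma Matrix.PosDef.exists_pos_mul_sq_norm_le {k : ℕ} {P : Matrix (Fin k) (Fin k) ℝ}
    (hP : P.PosDef) : ∃ c > 0, ∀ x : Fin k → ℝ, c * ‖x‖ ^ 2 ≤ x ⬝ᵥ (P *ᵥ x) := by
  obtain ⟨c, hc, h⟩ := (isCompact_sphere (0 : Fin k → ℝ) 1).exists_forall_le' (a := 0)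
    (f := fun x => x ⬝ᵥ (P *ᵥ x)) (by fun_prop) fun x hx => by
      have hx0 : x ≠ 0 := ne_zero_of_mem_unit_sphere (⟨x, hx⟩ : Metric.sphere (0 : Fin k → ℝ) 1)
      simpa using hP.dotProduct_mulVec_pos hx0
  refine ⟨c, hc, fun x => ?_⟩
  by_cases hx : x = 0
  · simp [hx]
  have hn : ‖x‖ ≠ 0 := norm_ne_zero_iff.mpr hx
  have h1 := h (‖x‖⁻¹ • x) (by simp [norm_smul, hn])
  simp only [mulVec_smul, dotProduct_smul, smul_dotProduct, smul_eq_mul] at h1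
  calc c * ‖x‖ ^ 2 ≤ (‖x‖⁻¹ * (‖x‖⁻¹ * (x ⬝ᵥ (P *ᵥ x)))) * ‖x‖ ^ 2 := by gcongr
    _ = x ⬝ᵥ (P *ᵥ x) := by field_simp

/-- The trace pairing with a positive definite matrix controls the entries of positive
semidefinite matrices. -/
lemma Matrix.PosDef.exists_pos_mul_abs_le_trace {k : ℕ} {P : Matrix (Fin k) (Fin k) ℝ}
    (hP : P.PosDef) : ∃ c > 0, ∀ X : Matrix (Fin k) (Fin k) ℝ, X.PosSemidef →
      ∀ i j, c * |X i j| ≤ (X * P).trace := by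
  obtain ⟨c, hc, h⟩ := hP.exists_pos_mul_sq_norm_le
  refine ⟨c, hc, fun X hX i j => ?_⟩
  obtain ⟨m, v, rfl⟩ := Matrix.posSemidef_iff_eq_sum_vecMulVec.mp hX
  have htr : ((∑ l, vecMulVec (v l) (star (v l))) * P).trace = ∑ l, v l ⬝ᵥ (P *ᵥ v l) := by
    rw [Finset.sum_mul, trace_sum]
    refine Finset.sum_congr rfl fun l _ => ?_
    rw [vecMulVec_mul, trace_vecMulVec, star_trivial, dotProduct_comm, dotProduct_mulVec]
  rw [htr]
  calc c * |(∑ l, vecMulVec (v l) (star (v l))) i j|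
      ≤ c * ∑ l, ‖v l‖ ^ 2 := by
        gcongr
        rw [Matrix.sum_apply]
        refine (Finset.abs_sum_le_sum_abs _ _).trans (Finset.sum_le_sum fun l _ => ?_)
        simp only [vecMulVec_apply, star_trivial, abs_mul, sq]
        exact mul_le_mul (norm_le_pi_norm (v l) i) (norm_le_pi_norm (v l) j) (abs_nonneg _)
          (norm_nonneg _)
    _ = ∑ l, c * ‖v l‖ ^ 2 := Finset.mul_sum _ _ _
    _ ≤ _ := Finset.sum_le_sum fun l _ => h (v l)

lemma isCompact_setOf_abs_apply_le {k l : ℕ} (c : ℝ) :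
    IsCompact {K : Matrix (Fin k) (Fin l) ℝ | ∀ i j, |K i j| ≤ c} := by
  have h : IsCompact (Set.univ.pi fun _ : Fin k => Set.univ.pi fun _ : Fin l => Set.Icc (-c) c) :=
    isCompact_univ_pi fun _ => isCompact_univ_pi fun _ => isCompact_Icc
  have he : {K : Matrix (Fin k) (Fin l) ℝ | ∀ i j, |K i j| ≤ c} =
      Set.univ.pi fun _ : Fin k => Set.univ.pi fun _ : Fin l => Set.Icc (-c) c := by
    ext K
    exact ⟨fun hK i _ j _ => abs_le.mp (hK i j),
      fun hK i j => abs_le.mpr (hK i (Set.mem_univ i) j (Set.mem_univ j))⟩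
  rw [he]
  exact h

theorem stmt4 {n m : ℕ} (hn : 0 < n) (hm : 0 < m)
    (A : Matrix (Fin n) (Fin n) ℝ) (B : Matrix (Fin n) (Fin m) ℝ)
    (Q Sig : Matrix (Fin n) (Fin n) ℝ) (R : Matrix (Fin m) (Fin m) ℝ)
    (hQ : Q.PosDef) (hR : R.PosDef) (hSig : Sig.PosDef)
    (X : Matrix (Fin m) (Fin n) ℝ → Matrix (Fin n) (Fin n) ℝ)
    (hX : ∀ K, IsSchur (A - B * K) →
      (A - B * K)ᵀ * X K * (A - B * K) + Kᵀ * R * K + Q = X K)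
    (α : ℝ) (hα : 0 < α) :
    IsCompact {K : Matrix (Fin m) (Fin n) ℝ |
      IsSchur (A - B * K) ∧ Matrix.trace (X K * Sig) ≤ α} := by
  obtain ⟨s, hs, hs'⟩ := hSig.exists_pos_mul_abs_le_trace
  obtain ⟨r, hr, hr'⟩ := hR.exists_pos_mul_sq_norm_le
  have hRK : ∀ K : Matrix (Fin m) (Fin n) ℝ, (Kᵀ * R * K).PosSemidef := fun K => by
    simpa using hR.posSemidef.conjTranspose_mul_mul_same K
  have hW : ∀ K : Matrix (Fin m) (Fin n) ℝ, (Kᵀ * R * K + Q).PosDef := fun K =>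
    hQ.posSemidef_add (hRK K)
  let T : Set (Matrix (Fin m) (Fin n) ℝ × Matrix (Fin n) (Fin n) ℝ) :=
    {p | p.2.PosSemidef ∧
      (A - B * p.1)ᵀ * p.2 * (A - B * p.1) + (p.1ᵀ * R * p.1 + Q) = p.2 ∧
      (p.2 * Sig).trace ≤ α}
  have hclosed : IsClosed T := by
    refine (isClosed_setOf_posSemidef.preimage continuous_snd).and
      (IsClosed.and (isClosed_eq ?_ ?_) (isClosed_le ?_ ?_)) <;> fun_prop
  have hbound : T ⊆ {K | ∀ i j, |K i j| ≤ √(α / s / r)} ×ˢ {Y | ∀ i j, |Y i j| ≤ α / s} := by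
    rintro ⟨K, Y⟩ ⟨hY, hKY, htr⟩
    have hYb : ∀ i j, |Y i j| ≤ α / s := fun i j => by
      rw [le_div_iff₀' hs]
      exact (hs' Y hY i j).trans htr
    refine ⟨fun i j => Real.abs_le_sqrt ?_, hYb⟩
    have hq := dotProduct_lyapunov hKY (Pi.single j 1)
    have h0 := hY.dotProduct_mulVec_nonneg ((A - B * K) *ᵥ Pi.single j 1)
    have hQ0 := hQ.posSemidef.dotProduct_mulVec_nonneg (Pi.single j 1)
    have hK := hr' (K *ᵥ Pi.single j 1)
    have hKe : (Pi.single j 1 : Fin n → ℝ) ⬝ᵥ ((Kᵀ * R * K) *ᵥ Pi.single j 1)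
        = (K *ᵥ Pi.single j 1) ⬝ᵥ (R *ᵥ (K *ᵥ Pi.single j 1)) := by
      rw [← mulVec_mulVec, ← mulVec_mulVec, dotProduct_mulVec _ Kᵀ, vecMul_transpose]
    have hYj : (Pi.single j 1 : Fin n → ℝ) ⬝ᵥ (Y *ᵥ Pi.single j 1) = Y j j := by simp
    rw [star_trivial] at h0 hQ0
    rw [add_mulVec, dotProduct_add, hKe, hYj] at hq
    have hYj' := (le_abs_self _).trans (hYb j j)
    have hKij : K i j ^ 2 ≤ ‖K *ᵥ Pi.single j 1‖ ^ 2 := by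
      have := norm_le_pi_norm (K *ᵥ Pi.single j 1) i
      rw [mulVec_single_one, Real.norm_eq_abs] at this
      rw [mulVec_single_one]
      exact sq_le_sq' (neg_le_of_abs_le this) (le_of_abs_le this)
    rw [le_div_iff₀' hr]
    linarith [mul_le_mul_of_nonneg_left hKij hr.le]
  have hT : IsCompact T := ((isCompact_setOf_abs_apply_le _).prod
    (isCompact_setOf_abs_apply_le _)).of_isClosed_subset hclosed hbound
  refine (congrArg IsCompact (Set.ext fun K => ?_)).mpr (hT.image continuous_fst)
  constructor
  · rintro ⟨hK, htr⟩
    have hKX := hX K hK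
    rw [add_assoc] at hKX
    exact ⟨(K, X K), ⟨hK.posSemidef_of_lyapunov (hW K).posSemidef hKX, hKX, htr⟩, rfl⟩
  · rintro ⟨⟨K, Y⟩, ⟨hY, hKY, htr⟩, rfl⟩
    have hK := isSchur_of_lyapunov hY (hW K) hKY
    have hKX := hX K hK
    rw [add_assoc] at hKX
    exact ⟨hK, hK.lyapunov_unique hKX hKY ▸ htr⟩
end
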